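/- The outputs of the approximate agreement step contract the diameter up to the perturbation: ‖y‖ ≤ ‖x‖/2 + 2δ, i.e., for all v, w ∈ C it holds that |y_v − y_w| ≤ (max_{u∈C} x_u − min_{u∈C} x_u)/2 + 2δ. -/

import Mathlib

/-- The `k`-th smallest element (1-indexed) of a multiset of reals. -/
noncomputable def kthSmallest (s : Multiset ℝ) (k : ℕ) : ℝ :=
  (s.sort (· ≤ ·)).getD (k - 1) 0

lemma countP_sort (s : Multiset ℝ) (p : ℝ → Prop) [DecidablePred p] :
    (s.sort (· ≤ ·)).countP (fun a => p a) = s.countP p := by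
  rw [← Multiset.coe_countP, Multiset.sort_eq]

lemma le_countP_le_kthSmallest (s : Multiset ℝ) {k : ℕ} (hk : 1 ≤ k) (hks : k ≤ s.card) :
    k ≤ s.countP (· ≤ kthSmallest s k) := by
  obtain ⟨i, rfl⟩ : ∃ i, k = i + 1 := ⟨k - 1, by omega⟩
  have hi : i < (s.sort (· ≤ ·)).length := by rw [Multiset.length_sort]; omega
  have hkth : kthSmallest s (i + 1) = (s.sort (· ≤ ·))[i] := by
    simp [kthSmallest, List.getElem?_eq_getElem hi]
  have hs := Multiset.pairwise_sort s (· ≤ ·)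
  rw [hkth, ← countP_sort]
  refine le_trans (le_of_eq ?_) ((List.take_sublist (i + 1) _).countP_le)
  rw [List.countP_eq_length.2, List.length_take]
  · omega
  · intro a ha
    obtain ⟨j, hj, rfl⟩ := List.mem_take_iff_getElem.1 ha
    have hji : j ≤ i := by omega
    rcases hji.eq_or_lt with rfl | hlt
    · simp
    · simpa using List.pairwise_iff_getElem.1 hs j i (by omega) hi hlt

lemma card_lt_add_countP_kthSmallest_le (s : Multiset ℝ) {k : ℕ} (hk : 1 ≤ k)
    (hks : k ≤ s.card) : s.card < k + s.countP (kthSmallest s k ≤ ·) := by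
  obtain ⟨i, rfl⟩ : ∃ i, k = i + 1 := ⟨k - 1, by omega⟩
  have hi : i < (s.sort (· ≤ ·)).length := by rw [Multiset.length_sort]; omega
  have hkth : kthSmallest s (i + 1) = (s.sort (· ≤ ·))[i] := by
    simp [kthSmallest, List.getElem?_eq_getElem hi]
  have hs := Multiset.pairwise_sort s (· ≤ ·)
  suffices h : s.card - i ≤ s.countP (kthSmallest s (i + 1) ≤ ·) by omega
  rw [hkth, ← countP_sort]
  refine le_trans (le_of_eq ?_) ((List.drop_sublist i _).countP_le)
  rw [List.countP_eq_length.2, List.length_drop, Multiset.length_sort]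
  intro a ha
  obtain ⟨j, hj, rfl⟩ := List.mem_drop_iff_getElem.1 ha
  rcases Nat.eq_zero_or_pos j with rfl | hlt
  · simp
  · simpa using List.pairwise_iff_getElem.1 hs i (i + j) hi (by omega) (by omega)

lemma countP_le_add_countP_le_of_lt (s : Multiset ℝ) {a b : ℝ} (hab : a < b) :
    s.countP (· ≤ a) + s.countP (b ≤ ·) ≤ s.card := by
  rw [s.card_eq_countP_add_countP (· ≤ a)]
  gcongr
  simp only [Multiset.countP_eq_card_filter]
  exact Multiset.card_le_card
    (Multiset.monotone_filter_right s fun c hc => not_le.2 (hab.trans_le hc))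

lemma kthSmallest_le {s : Multiset ℝ} {k : ℕ} {c : ℝ} (hk : 1 ≤ k)
    (h : k ≤ s.countP (· ≤ c)) : kthSmallest s k ≤ c := by
  by_contra! hc
  have h1 := card_lt_add_countP_kthSmallest_le s hk (h.trans (Multiset.countP_le_card _ _))
  have h2 := countP_le_add_countP_le_of_lt s hc
  omega

lemma le_kthSmallest {s : Multiset ℝ} {k : ℕ} {c : ℝ} (hk : 1 ≤ k) (hks : k ≤ s.card)
    (h : s.card < k + s.countP (c ≤ ·)) : c ≤ kthSmallest s k := by
  by_contra! hc
  have h1 := le_countP_le_kthSmallest s hk hks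
  have h2 := countP_le_add_countP_le_of_lt s hc
  omega

lemma countP_map_le_countP_map_univ {V : Type*} [Fintype V] (C : Finset V) (g h : V → ℝ)
    (p q : ℝ → Prop) [DecidablePred p] [DecidablePred q] (hpq : ∀ w ∈ C, p (g w) → q (h w)) :
    (C.val.map g).countP p ≤ ((Finset.univ : Finset V).val.map h).countP q := by
  rw [Multiset.countP_map, Multiset.countP_map]
  change (C.filter fun w => p (g w)).card ≤ (Finset.univ.filter fun w => q (h w)).card
  refine Finset.card_le_card fun w hw => ?_
  rw [Finset.mem_filter] at hw
  simpa using hpq w hw.1 hw.2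

/-- An approximate agreement step contracts the diameter of the correct nodes'
values up to the perturbation: `‖y‖ ≤ ‖x‖/2 + 2δ`. -/
theorem approx_agreement_convergence
    {V : Type*} [Fintype V]
    (C : Finset V) (f : ℕ)
    (hf : 3 * f < Fintype.card V)
    (hC : C.card = Fintype.card V - f)
    (hCne : C.Nonempty)
    (δ : ℝ) (hδ : 0 ≤ δ)
    (x : V → ℝ) (xhat : V → V → ℝ)
    (hest : ∀ v ∈ C, ∀ w ∈ C, |xhat w v - x w| ≤ δ)
    (y : V → ℝ)
    (hy : ∀ v ∈ C, y v =
      (kthSmallest ((Finset.univ : Finset V).val.map (fun w => xhat w v)) (f + 1)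
        + kthSmallest ((Finset.univ : Finset V).val.map (fun w => xhat w v))
            (Fintype.card V - f)) / 2) :
    ∀ v ∈ C, ∀ w ∈ C,
      |y v - y w| ≤ (C.sup' hCne x - C.inf' hCne x) / 2 + 2 * δ := by
  set S : V → Multiset ℝ := fun v => (Finset.univ : Finset V).val.map (fun w => xhat w v) with hS
  set t := kthSmallest (C.val.map x) (f + 1) with ht
  have hcardC : (C.val.map x).card = Fintype.card V - f := by simpa using hC
  have hcardS : ∀ v, (S v).card = Fintype.card V := fun v => by simp [hS]
  have hbelow := le_countP_le_kthSmallest (C.val.map x) (k := f + 1) (by omega) (by omega)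
  have habove := card_lt_add_countP_kthSmallest_le (C.val.map x) (k := f + 1) (by omega) (by omega)
  rw [← ht] at hbelow habove
  have hall : ∀ p : ℝ → Prop, ∀ [DecidablePred p], (∀ w ∈ C, p (x w)) →
      (C.val.map x).countP p = Fintype.card V - f := by
    intro p _ hp
    rw [← hcardC, Multiset.countP_eq_card]
    simpa using hp
  have key : ∀ v ∈ C, C.inf' hCne x - δ ≤ kthSmallest (S v) (f + 1) ∧
      kthSmallest (S v) (f + 1) ≤ t + δ ∧ t - δ ≤ kthSmallest (S v) (Fintype.card V - f) ∧
      kthSmallest (S v) (Fintype.card V - f) ≤ C.sup' hCne x + δ := by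
    intro v hv
    have hle : ∀ c, (C.val.map x).countP (· ≤ c) ≤ (S v).countP (· ≤ c + δ) := fun c =>
      countP_map_le_countP_map_univ C x _ _ _ fun w hw h => by
        linarith [(abs_le.1 (hest v hv w hw)).2]
    have hge : ∀ c, (C.val.map x).countP (c ≤ ·) ≤ (S v).countP (c - δ ≤ ·) := fun c =>
      countP_map_le_countP_map_univ C x _ _ _ fun w hw h => by
        linarith [(abs_le.1 (hest v hv w hw)).1]
    have hinf := hall (C.inf' hCne x ≤ ·) fun w hw => Finset.inf'_le x hw
    have hsup := hall (· ≤ C.sup' hCne x) fun w hw => Finset.le_sup' x hw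
    have hcard := hcardS v
    refine ⟨le_kthSmallest (by omega) (by omega) ?_, kthSmallest_le (by omega) ?_,
      le_kthSmallest (by omega) (by omega) ?_, kthSmallest_le (by omega) ?_⟩
    · have := hge (C.inf' hCne x)
      omega
    · exact hbelow.trans (hle t)
    · have := hge t
      omega
    · exact hsup.symm.le.trans (hle _)
  intro v hv w hw
  obtain ⟨hv1, hv2, hv3, hv4⟩ := key v hv
  obtain ⟨hw1, hw2, hw3, hw4⟩ := key w hw
  rw [hy v hv, hy w hw, abs_le]
  constructor <;> linarith
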